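/- Pairwise decorrelating obfuscation (key construction for achieving perfect privacy under pairwise dependence): let (X, X') be a pair of {0,1}-valued random variables with P(X = 1) = p ∈ (0,1), P(X' = 1) = p' ∈ (0,1), and covariance γ = Cov(X, X'). Then there exist {0,1}-valued random variables Z and Z', defined on an extension of the probability space (i.e., obtained from (X, X') together with auxiliary randomness independent of (X, X')), such that Z and Z' are independent, P(Z = 1) = p, P(Z' = 1) = p', and both P(Z ≠ X) ≤ a and P(Z' ≠ X') ≤ a, where a = |γ| / max{p, p', 1 − p, 1 − p'}. -/

import Mathlib

open MeasureTheory ProbabilityTheory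

namespace PairwiseDecorrelation

noncomputable section

/-- The covariance of two `{0,1}`-valued random variables. -/
def cov2 {Ω : Type*} [MeasurableSpace Ω] (μ : Measure Ω) (X X' : Ω → Fin 2) : ℝ :=
  (∫ ω, (((X ω : ℕ) : ℝ) * ((X' ω : ℕ) : ℝ)) ∂μ) -
    (∫ ω, ((X ω : ℕ) : ℝ) ∂μ) * (∫ ω, ((X' ω : ℕ) : ℝ) ∂μ)

/-- The law of a set fibred over a finite-valued random variable, in a product space. -/
theorem measureReal_prod_setOf_mem {Ω Aux ι : Type*} [MeasurableSpace Ω] [MeasurableSpace Aux]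
    [Fintype ι] [MeasurableSpace ι] [MeasurableSingletonClass ι]
    (μ : Measure Ω) [IsProbabilityMeasure μ] (ν : Measure Aux) [IsProbabilityMeasure ν]
    {C : Ω → ι} (hC : Measurable C) {S : ι → Set Aux} (hS : ∀ c, MeasurableSet (S c)) :
    (μ.prod ν).real {w | w.2 ∈ S (C w.1)} = ∑ c, μ.real (C ⁻¹' {c}) * ν.real (S c) := by
  have h : {w : Ω × Aux | w.2 ∈ S (C w.1)} = ⋃ c, (C ⁻¹' {c}) ×ˢ S c := by
    ext w
    simp
  rw [h, measureReal_iUnion_fintype]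
  · simp [measureReal_prod_prod]
  · intro c d hcd
    refine Set.disjoint_left.2 fun w hc hd => hcd ?_
    exact hc.1.symm.trans hd.1
  · exact fun c => (hC (measurableSet_singleton c)).prod (hS c)

theorem measurable_fin_two_of_preimage_one {Ω : Type*} [MeasurableSpace Ω] {Y : Ω → Fin 2}
    (h : MeasurableSet (Y ⁻¹' {1})) : Measurable Y := by
  refine measurable_to_countable' fun i => ?_
  fin_cases i
  · have h0 : Y ⁻¹' {0} = (Y ⁻¹' {1})ᶜ := by
      ext w
      simp only [Set.mem_preimage, Set.mem_singleton_iff, Set.mem_compl_iff]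
      omega
    exact h0 ▸ h.compl
  · exact h

/-- Two `{0,1}`-valued random variables are independent as soon as the events that they equal `1`
are. -/
theorem indepFun_of_measureReal_inter {Ω : Type*} [MeasurableSpace Ω] {μ : Measure Ω}
    [IsProbabilityMeasure μ] {Z Z' : Ω → Fin 2} (hZ : Measurable Z) (hZ' : Measurable Z')
    (h : μ.real {w | Z w = 1 ∧ Z' w = 1} = μ.real {w | Z w = 1} * μ.real {w | Z' w = 1}) :
    IndepFun Z Z' μ := by
  have hs : IndepSet (Z ⁻¹' {1}) (Z' ⁻¹' {1}) μ := by
    rw [indepSet_iff_measure_inter_eq_mul (hZ (measurableSet_singleton 1))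
      (hZ' (measurableSet_singleton 1)) μ, ← ENNReal.toReal_eq_toReal_iff' (by finiteness)
      (by finiteness), ENNReal.toReal_mul]
    exact h
  have hle (Y : Ω → Fin 2) :
      MeasurableSpace.comap Y inferInstance ≤ MeasurableSpace.generateFrom {Y ⁻¹' {1}} :=
    Measurable.comap_le <| @measurable_fin_two_of_preimage_one _ (_) _ <|
      MeasurableSpace.measurableSet_generateFrom rfl
  exact indep_of_indep_of_le_left (indep_of_indep_of_le_right hs (hle Z')) (hle Z)

/-- The expectation of a `{0,1}`-valued random variable. -/
theorem integral_natCast_fin_two {Ω : Type*} [MeasurableSpace Ω] (μ : Measure Ω)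
    {X : Ω → Fin 2} (hX : Measurable X) :
    ∫ ω, ((X ω : ℕ) : ℝ) ∂μ = μ.real {ω | X ω = 1} := by
  have h : (fun ω => ((X ω : ℕ) : ℝ)) = {ω | X ω = 1}.indicator 1 := by
    ext ω
    rcases Fin.exists_fin_two.1 ⟨X ω, rfl⟩ with h | h <;> simp [Set.indicator, h]
  rw [h]
  exact integral_indicator_one (hX (measurableSet_singleton 1))

theorem cov2_eq_measureReal {Ω : Type*} [MeasurableSpace Ω] (μ : Measure Ω)
    {X X' : Ω → Fin 2} (hX : Measurable X) (hX' : Measurable X') :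
    cov2 μ X X' = μ.real {ω | X ω = 1 ∧ X' ω = 1} -
      μ.real {ω | X ω = 1} * μ.real {ω | X' ω = 1} := by
  have h := integral_natCast_fin_two μ (hX.mul hX')
  have hmul (x y : Fin 2) : ((x * y : Fin 2) : ℕ) = x * y := by
    fin_cases x <;> fin_cases y <;> rfl
  have hone (x y : Fin 2) : x * y = 1 ↔ x = 1 ∧ y = 1 := by
    fin_cases x <;> fin_cases y <;> decide
  simp only [Pi.mul_apply, hmul, hone, Nat.cast_mul] at h
  rw [cov2, h, integral_natCast_fin_two μ hX, integral_natCast_fin_two μ hX']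

/-- The first sample of a pair after obfuscation with flip rate `t`: it is flipped when the
auxiliary variable lies in `[0, t)`. -/
def flipFst (t : Fin 2 × Fin 2 → ℝ) (c : Fin 2 × Fin 2) (u : ℝ) : Fin 2 :=
  if u ∈ Set.Ico 0 (t c) then c.1 + 1 else c.1

/-- The second sample of a pair after obfuscation with flip rate `t`: it is flipped when the
auxiliary variable lies in `[t, 2 * t)`. -/
def flipSnd (t : Fin 2 × Fin 2 → ℝ) (c : Fin 2 × Fin 2) (u : ℝ) : Fin 2 :=
  if u ∈ Set.Ico (t c) (2 * t c) then c.2 + 1 else c.2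

theorem measurable_flipFst (t : Fin 2 × Fin 2 → ℝ) (c : Fin 2 × Fin 2) :
    Measurable (flipFst t c) :=
  Measurable.ite measurableSet_Ico measurable_const measurable_const

theorem measurable_flipSnd (t : Fin 2 × Fin 2 → ℝ) (c : Fin 2 × Fin 2) :
    Measurable (flipSnd t c) :=
  Measurable.ite measurableSet_Ico measurable_const measurable_const

theorem fin_two_add_one_eq_one_iff (x : Fin 2) : x + 1 = 1 ↔ x ≠ 1 := by
  fin_cases x <;> decide

theorem setOf_flipFst_ne (t : Fin 2 × Fin 2 → ℝ) (c : Fin 2 × Fin 2) :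
    {u | flipFst t c u ≠ c.1} = Set.Ico 0 (t c) := by
  ext u
  simp [flipFst]

theorem setOf_flipSnd_ne (t : Fin 2 × Fin 2 → ℝ) (c : Fin 2 × Fin 2) :
    {u | flipSnd t c u ≠ c.2} = Set.Ico (t c) (2 * t c) := by
  ext u
  simp [flipSnd]

theorem setOf_flipFst_eq_one (t : Fin 2 × Fin 2 → ℝ) (c : Fin 2 × Fin 2) :
    {u | flipFst t c u = 1} = if c.1 = 1 then (Set.Ico 0 (t c))ᶜ else Set.Ico 0 (t c) := by
  ext u
  by_cases h : u ∈ Set.Ico 0 (t c) <;> by_cases hc : c.1 = 1 <;>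
    simp only [flipFst, h, hc, Set.mem_ofPred_eq, Set.mem_compl_iff, if_true, if_false,
      fin_two_add_one_eq_one_iff] <;> simp [hc]

theorem setOf_flipSnd_eq_one (t : Fin 2 × Fin 2 → ℝ) (c : Fin 2 × Fin 2) :
    {u | flipSnd t c u = 1} =
      if c.2 = 1 then (Set.Ico (t c) (2 * t c))ᶜ else Set.Ico (t c) (2 * t c) := by
  ext u
  by_cases h : u ∈ Set.Ico (t c) (2 * t c) <;> by_cases hc : c.2 = 1 <;>
    simp only [flipSnd, h, hc, Set.mem_ofPred_eq, Set.mem_compl_iff, if_true, if_false,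
      fin_two_add_one_eq_one_iff] <;> simp [hc]

theorem setOf_flip_eq_one (t : Fin 2 × Fin 2 → ℝ) (c : Fin 2 × Fin 2) (ht : 0 ≤ t c) :
    {u | flipFst t c u = 1 ∧ flipSnd t c u = 1} =
      if c.1 = 1 then if c.2 = 1 then (Set.Ico 0 (2 * t c))ᶜ else Set.Ico (t c) (2 * t c)
      else if c.2 = 1 then Set.Ico 0 (t c) else ∅ := by
  rw [Set.ofPred_and, setOf_flipFst_eq_one, setOf_flipSnd_eq_one]
  ext u
  split_ifs <;> simp only [Set.mem_inter_iff, Set.mem_compl_iff, Set.mem_Ico,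
    Set.mem_empty_iff_false] <;> grind

/-- The uniform distribution on the unit interval. -/
def unif : Measure ℝ := volume.restrict (Set.Icc 0 1)

instance : IsProbabilityMeasure unif :=
  ⟨by simp [unif]⟩

theorem unif_real_Ico {x y : ℝ} (hx : 0 ≤ x) (hxy : x ≤ y) (hy : y ≤ 1) :
    unif.real (Set.Ico x y) = y - x := by
  have h : Set.Ico x y ∩ Set.Icc 0 1 = Set.Ico x y :=
    Set.inter_eq_left.2 fun u hu => ⟨hx.trans hu.1, hu.2.le.trans hy⟩
  rw [unif, measureReal_restrict_apply measurableSet_Ico, h, Real.volume_real_Ico_of_le hxy]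

theorem exists_flip_rate {q d : ℝ} (hd : 0 ≤ d) (hq : 2 * d ≤ q) :
    ∃ t, 0 ≤ t ∧ 2 * t ≤ 1 ∧ q * t = d := by
  rcases (by linarith : 0 ≤ q).eq_or_lt with h | h
  · exact ⟨0, le_rfl, by norm_num, by linarith⟩
  · refine ⟨d / q, by positivity, ?_, by field_simp⟩
    rw [← mul_div_assoc]
    exact (div_le_one h).2 hq

/-- Pairwise decorrelating obfuscation.
Given a pair `(X, X')` of `{0,1}`-valued random variables with `P(X = 1) = p ∈ (0,1)`,
`P(X' = 1) = p' ∈ (0,1)` and covariance `γ`, there is an extension of the probability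
space by independent auxiliary randomness carrying `{0,1}`-valued random variables
`Z, Z'` that are independent, have the same marginals `Bernoulli(p)`, `Bernoulli(p')`,
and satisfy `P(Z ≠ X) ≤ a` and `P(Z' ≠ X') ≤ a`, where
`a = |γ| / max {p, p', 1 - p, 1 - p'}`. -/
theorem exists_pairwise_decorrelating_obfuscation
    {Ω : Type*} [MeasurableSpace Ω] (μ : Measure Ω) [IsProbabilityMeasure μ]
    (p p' γ a : ℝ) (hp : p ∈ Set.Ioo (0 : ℝ) 1) (hp' : p' ∈ Set.Ioo (0 : ℝ) 1)
    (X X' : Ω → Fin 2) (hX : Measurable X) (hX' : Measurable X')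
    (hpX : μ {ω | X ω = 1} = ENNReal.ofReal p)
    (hpX' : μ {ω | X' ω = 1} = ENNReal.ofReal p')
    (hγ : γ = cov2 μ X X')
    (ha : a = |γ| / max (max p p') (max (1 - p) (1 - p'))) :
    ∃ (Aux : Type) (_ : MeasurableSpace Aux) (ν : Measure Aux) (_ : IsProbabilityMeasure ν)
      (Z Z' : Ω × Aux → Fin 2),
      Measurable Z ∧ Measurable Z' ∧
      IndepFun Z Z' (μ.prod ν) ∧
      (μ.prod ν) {ω | Z ω = 1} = ENNReal.ofReal p ∧
      (μ.prod ν) {ω | Z' ω = 1} = ENNReal.ofReal p' ∧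
      (μ.prod ν) {ω | Z ω ≠ X ω.1} ≤ ENNReal.ofReal a ∧
      (μ.prod ν) {ω | Z' ω ≠ X' ω.1} ≤ ENNReal.ofReal a := by
  have hC : Measurable fun ω => (X ω, X' ω) := hX.prodMk hX'
  obtain ⟨q, hq⟩ : ∃ q : Fin 2 × Fin 2 → ℝ,
      ∀ c, μ.real ((fun ω => (X ω, X' ω)) ⁻¹' {c}) = q c := ⟨_, fun _ => rfl⟩
  have hq0 (c) : 0 ≤ q c := hq c ▸ measureReal_nonneg
  have hmix {S : Fin 2 × Fin 2 → Set ℝ} (hS : ∀ c, MeasurableSet (S c)) :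
      (μ.prod unif).real {w | w.2 ∈ S (X w.1, X' w.1)} = ∑ c, q c * unif.real (S c) := by
    simp only [measureReal_prod_setOf_mem μ unif hC hS, hq]
  have hlaw (S : Set (Fin 2 × Fin 2)) [DecidablePred (· ∈ S)] :
      μ.real {ω | (X ω, X' ω) ∈ S} = ∑ c, if c ∈ S then q c else 0 := by
    have h := hmix (S := fun c => {_u : ℝ | c ∈ S})
      (fun c => MeasurableSet.const _)
    have h' : {w : Ω × ℝ | w.2 ∈ {_u : ℝ | (X w.1, X' w.1) ∈ S}} =
        {ω | (X ω, X' ω) ∈ S} ×ˢ Set.univ := by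
      ext w
      simp
    rw [h', measureReal_prod_prod, probReal_univ, mul_one] at h
    rw [h]
    refine Finset.sum_congr rfl fun c _ => ?_
    by_cases hc : c ∈ S <;> simp [hc]
  have hp1 : μ.real {ω | X ω = 1} = p := by
    rw [measureReal_def, hpX, ENNReal.toReal_ofReal hp.1.le]
  have hp1' : μ.real {ω | X' ω = 1} = p' := by
    rw [measureReal_def, hpX', ENNReal.toReal_ofReal hp'.1.le]
  have e1 : p = q (1, 0) + q (1, 1) := by
    rw [← hp1]
    simpa [Fintype.sum_prod_type] using hlaw {c | c.1 = 1}
  have e2 : p' = q (0, 1) + q (1, 1) := by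
    rw [← hp1']
    simpa [Fintype.sum_prod_type] using hlaw {c | c.2 = 1}
  have e3 : 1 = q (0, 0) + q (0, 1) + (q (1, 0) + q (1, 1)) := by
    simpa [Fintype.sum_prod_type] using hlaw Set.univ
  have e4 : γ = q (1, 1) - p * p' := by
    rw [hγ, cov2_eq_measureReal μ hX hX', hp1, hp1', ← hq]
    congr 2
    ext ω
    simp
  obtain ⟨hp0, hpl⟩ := hp
  obtain ⟨hp0', hpl'⟩ := hp'
  have hγa : |γ| ≤ a := by
    rw [ha]
    refine le_div_self (abs_nonneg _) (lt_max_of_lt_left (lt_max_of_lt_left hp0)) ?_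
    simp only [max_le_iff]
    refine ⟨⟨?_, ?_⟩, ?_, ?_⟩ <;> linarith
  have hγq (x y : Fin 2) : (if x = y then γ else -γ) ≤ q (x, y) := by
    fin_cases x <;> fin_cases y <;> simp <;>
      nlinarith [mul_pos hp0 hp0', mul_pos (sub_pos.2 hpl) hp0', mul_pos hp0 (sub_pos.2 hpl'),
        mul_pos (sub_pos.2 hpl) (sub_pos.2 hpl')]
  obtain ⟨d, hd0, hdq, s1, s2, s3, s4⟩ : ∃ d : Fin 2 × Fin 2 → ℝ,
      (∀ c, 0 ≤ d c) ∧ (∀ c, 2 * d c ≤ q c) ∧ d (0, 0) = d (1, 1) ∧ d (0, 1) = d (1, 0) ∧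
      2 * d (1, 1) - 2 * d (1, 0) = γ ∧ 2 * d (1, 1) + 2 * d (1, 0) = |γ| := by
    refine ⟨fun c => max 0 (if c.1 = c.2 then γ else -γ) / 2,
      fun c => div_nonneg (le_max_left _ _) zero_le_two, fun c => ?_, ?_⟩
    · rw [mul_div_cancel₀ _ two_ne_zero]
      exact max_le (hq0 c) (hγq c.1 c.2)
    · rcases le_total 0 γ with h | h <;>
        simp [h, abs_of_nonneg, abs_of_nonpos, mul_div_cancel₀]
  choose t ht0 ht1 htd using fun c =>
    exists_flip_rate (hd0 c) (hdq c)
  have hA (c) : unif.real (Set.Ico 0 (t c)) = t c := by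
    rw [unif_real_Ico le_rfl (ht0 c) (by linarith [ht0 c, ht1 c]), sub_zero]
  have hB (c) : unif.real (Set.Ico (t c) (2 * t c)) = t c := by
    rw [unif_real_Ico (ht0 c) (by linarith [ht0 c]) (ht1 c)]
    ring
  have hAB (c) : unif.real (Set.Ico 0 (2 * t c)) = 2 * t c := by
    rw [unif_real_Ico le_rfl (by linarith [ht0 c]) (ht1 c), sub_zero]
  have hcompl (x y : ℝ) : unif.real (Set.Ico x y)ᶜ = 1 - unif.real (Set.Ico x y) :=
    probReal_compl_eq_one_sub measurableSet_Ico
  set Z : Ω × ℝ → Fin 2 := fun w => flipFst t (X w.1, X' w.1) w.2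
  set Z' : Ω × ℝ → Fin 2 := fun w => flipSnd t (X w.1, X' w.1) w.2
  have hZ : Measurable Z :=
    (measurable_from_prod_countable_right (measurable_flipFst t) :
      Measurable fun v : (Fin 2 × Fin 2) × ℝ => flipFst t v.1 v.2).comp
        ((hC.comp measurable_fst).prodMk measurable_snd)
  have hZ' : Measurable Z' :=
    (measurable_from_prod_countable_right (measurable_flipSnd t) :
      Measurable fun v : (Fin 2 × Fin 2) × ℝ => flipSnd t v.1 v.2).comp
        ((hC.comp measurable_fst).prodMk measurable_snd)
  have hfst (i : Fin 2) (c) : MeasurableSet {u | flipFst t c u = i} :=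
    measurable_flipFst t c (measurableSet_singleton i)
  have hsnd (i : Fin 2) (c) : MeasurableSet {u | flipSnd t c u = i} :=
    measurable_flipSnd t c (measurableSet_singleton i)
  have m1 : (μ.prod unif).real {w | Z w = 1} = p := by
    refine (hmix (hfst 1)).trans ?_
    simp only [setOf_flipFst_eq_one, Fintype.sum_prod_type, Fin.sum_univ_two]
    simp [hcompl, hA]
    linarith [htd (0, 0), htd (0, 1), htd (1, 0), htd (1, 1)]
  have m2 : (μ.prod unif).real {w | Z' w = 1} = p' := by
    refine (hmix (hsnd 1)).trans ?_
    simp only [setOf_flipSnd_eq_one, Fintype.sum_prod_type, Fin.sum_univ_two]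
    simp [hcompl, hB]
    linarith [htd (0, 0), htd (0, 1), htd (1, 0), htd (1, 1)]
  have m12 : (μ.prod unif).real {w | Z w = 1 ∧ Z' w = 1} = p * p' := by
    refine (hmix fun c => (hfst 1 c).inter (hsnd 1 c)).trans ?_
    simp only [← Set.ofPred_and, setOf_flip_eq_one _ _ (ht0 _), Fintype.sum_prod_type,
      Fin.sum_univ_two]
    simp [hcompl, hA, hB, hAB]
    linarith [htd (0, 0), htd (0, 1), htd (1, 0), htd (1, 1)]
  have n1 : (μ.prod unif).real {w | Z w ≠ X w.1} = |γ| := by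
    refine (hmix (S := fun c => {u | flipFst t c u ≠ c.1})
      fun c => (hfst c.1 c).compl).trans ?_
    simp only [setOf_flipFst_ne, hA, Fintype.sum_prod_type, Fin.sum_univ_two]
    linarith [htd (0, 0), htd (0, 1), htd (1, 0), htd (1, 1)]
  have n2 : (μ.prod unif).real {w | Z' w ≠ X' w.1} = |γ| := by
    refine (hmix (S := fun c => {u | flipSnd t c u ≠ c.2})
      fun c => (hsnd c.2 c).compl).trans ?_
    simp only [setOf_flipSnd_ne, hB, Fintype.sum_prod_type, Fin.sum_univ_two]
    linarith [htd (0, 0), htd (0, 1), htd (1, 0), htd (1, 1)]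
  refine ⟨ℝ, inferInstance, unif, inferInstance, Z, Z', hZ, hZ',
    indepFun_of_measureReal_inter hZ hZ' (by rw [m12, m1, m2]), ?_, ?_, ?_, ?_⟩
  · rw [← m1, ofReal_measureReal]
  · rw [← m2, ofReal_measureReal]
  · rw [← ofReal_measureReal, n1]
    exact ENNReal.ofReal_le_ofReal hγa
  · rw [← ofReal_measureReal, n2]
    exact ENNReal.ofReal_le_ofReal hγa

end

end PairwiseDecorrelation
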